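/- arXiv:2001.09007 — 3 statements merged into one kernel-verified Lean document; each statement's English description precedes it below -/
import Mathlib

section
/- Let d be a natural number and let P and Q be Borel probability measures on ℝ whose absolute moments up to order d are finite. Write m_k(P) = ∫ x^k dP(x) for the k-th moment. Then the squared maximum mean discrepancy of P and Q with respect to the polynomial kernel k(x,y) = (1 + x·y)^d, namely MMD²(P,Q) = ∫∫ (1+xy)^d dP(x)dP(y) − 2∫∫ (1+xy)^d dP(x)dQ(y) + ∫∫ (1+xy)^d dQ(x)dQ(y), satisfies MMD²(P,Q) = ∑_{k=0}^{d} C(d,k) · (m_k(P) − m_k(Q))², where C(d,k) denotes the binomial coefficient. -/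
open MeasureTheory

/-- A power of the identity is integrable as soon as the corresponding absolute power is. -/
theorem integrable_pow_of_integrable_abs_pow {μ : Measure ℝ} {k : ℕ}
    (h : Integrable (fun x : ℝ => |x| ^ k) μ) : Integrable (fun x : ℝ => x ^ k) μ := by
  refine h.mono' (by fun_prop) (Filter.Eventually.of_forall fun x => ?_)
  simp

/-- The double integral of the polynomial kernel, expanded in products of moments. -/
theorem integral_integral_one_add_mul_pow {d : ℕ} {μ ν : Measure ℝ}
    (hμ : ∀ k ≤ d, Integrable (fun x : ℝ => x ^ k) μ)
    (hν : ∀ k ≤ d, Integrable (fun x : ℝ => x ^ k) ν) :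
    ∫ x, ∫ y, (1 + x * y) ^ d ∂ν ∂μ
      = ∑ k ∈ Finset.range (d + 1),
        (d.choose k : ℝ) * ((∫ x, x ^ k ∂μ) * ∫ y, y ^ k ∂ν) := by
  have inner_integral (x : ℝ) : ∫ y, (1 + x * y) ^ d ∂ν
      = ∑ k ∈ Finset.range (d + 1), (d.choose k * ∫ y, y ^ k ∂ν) * x ^ k := by
    have expand (y : ℝ) : (1 + x * y) ^ d
        = ∑ k ∈ Finset.range (d + 1), (d.choose k * x ^ k) * y ^ k := by
      rw [add_comm, add_pow]
      refine Finset.sum_congr rfl fun k _ => ?_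
      rw [one_pow, mul_pow]
      ring
    simp_rw [expand]
    rw [integral_finsetSum _ fun k hk =>
      (hν k (Finset.mem_range_succ_iff.mp hk)).const_mul _]
    refine Finset.sum_congr rfl fun k _ => ?_
    rw [integral_const_mul]
    ring
  simp_rw [inner_integral]
  rw [integral_finsetSum _ fun k hk =>
    (hμ k (Finset.mem_range_succ_iff.mp hk)).const_mul _]
  refine Finset.sum_congr rfl fun k _ => ?_
  rw [integral_const_mul]
  ring

/-- Squared MMD with the order-`d` polynomial kernel equals the binomially
weighted sum of squared moment differences. -/
theorem mmd_sq_eq_sum_moment_diff_sq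
    (d : ℕ) (P Q : Measure ℝ) [IsProbabilityMeasure P] [IsProbabilityMeasure Q]
    (hP : ∀ k ≤ d, Integrable (fun x : ℝ => |x| ^ k) P)
    (hQ : ∀ k ≤ d, Integrable (fun x : ℝ => |x| ^ k) Q) :
    (∫ x, ∫ y, (1 + x * y) ^ d ∂P ∂P)
      - 2 * (∫ x, ∫ y, (1 + x * y) ^ d ∂Q ∂P)
      + (∫ x, ∫ y, (1 + x * y) ^ d ∂Q ∂Q)
    = ∑ k ∈ Finset.range (d + 1),
        (d.choose k : ℝ) * ((∫ x, x ^ k ∂P) - (∫ x, x ^ k ∂Q)) ^ 2 := by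
  have hP' := fun k hk => integrable_pow_of_integrable_abs_pow (hP k hk)
  have hQ' := fun k hk => integrable_pow_of_integrable_abs_pow (hQ k hk)
  rw [integral_integral_one_add_mul_pow hP' hP', integral_integral_one_add_mul_pow hP' hQ',
    integral_integral_one_add_mul_pow hQ' hQ', Finset.mul_sum, ← Finset.sum_sub_distrib,
    ← Finset.sum_add_distrib]
  refine Finset.sum_congr rfl fun k _ => ?_
  ring
end

section
/- Let d be a natural number and let P and Q be Borel probability measures on ℝ whose absolute moments up to order d are finite. Define the kernel mean embedding of P with respect to the polynomial kernel of order d as the function μ_P : ℝ → ℝ, μ_P(t) = ∫ (1 + t·x)^d dP(x), and similarly μ_Q for Q. Then μ_P(t) = μ_Q(t) for every t ∈ ℝ if and only if m_k(P) = m_k(Q) for every 0 ≤ k ≤ d, where m_k denotes the k-th moment. (This is the paper's Theorem 2: vanishing of the MMD under a polynomial kernel of order d is equivalent to agreement of all moments up to order d.) -/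
open MeasureTheory

/-- The mean embedding of a measure under the polynomial kernel of order `d` is a polynomial whose
coefficients are its moments scaled by binomial coefficients. -/
theorem integral_one_add_mul_pow (d : ℕ) (P : Measure ℝ)
    (hP : ∀ k ≤ d, Integrable (fun x : ℝ => |x| ^ k) P) (t : ℝ) :
    ∫ x, (1 + t * x) ^ d ∂P =
      ∑ k ∈ Finset.range (d + 1), (d.choose k * ∫ x, x ^ k ∂P) * t ^ k := by
  have hint : ∀ k ≤ d, Integrable (fun x : ℝ => x ^ k) P := fun k hk =>
    (hP k hk).mono' (by fun_prop) (by simp)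
  have hexp : ∀ x : ℝ, (1 + t * x) ^ d =
      ∑ k ∈ Finset.range (d + 1), (d.choose k * t ^ k) * x ^ k := fun x => by
    rw [add_comm, add_pow]
    exact Finset.sum_congr rfl fun k _ => by rw [mul_pow, one_pow]; ring
  simp_rw [hexp]
  rw [integral_finsetSum _ fun k hk =>
    (hint k (Finset.mem_range_succ_iff.mp hk)).const_mul _]
  exact Finset.sum_congr rfl fun k _ => by rw [integral_const_mul]; ring

/-- The kernel mean embeddings (w.r.t. the order-`d` polynomial kernel) of two
probability measures on `ℝ` coincide iff their moments up to order `d` agree. -/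
theorem polyKernel_embedding_eq_iff_moments_eq
    (d : ℕ) (P Q : Measure ℝ) [IsProbabilityMeasure P] [IsProbabilityMeasure Q]
    (hP : ∀ k ≤ d, Integrable (fun x : ℝ => |x| ^ k) P)
    (hQ : ∀ k ≤ d, Integrable (fun x : ℝ => |x| ^ k) Q) :
    (∀ t : ℝ, (∫ x, (1 + t * x) ^ d ∂P) = ∫ x, (1 + t * x) ^ d ∂Q)
      ↔ (∀ k ≤ d, (∫ x, x ^ k ∂P) = ∫ x, x ^ k ∂Q) := by
  simp_rw [integral_one_add_mul_pow d P hP, integral_one_add_mul_pow d Q hQ]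
  refine ⟨fun h k hk => ?_, fun h t => Finset.sum_congr rfl fun k hk => by
    rw [h k (Finset.mem_range_succ_iff.mp hk)]⟩
  have hpoly : ∑ k ∈ Finset.range (d + 1),
        Polynomial.monomial k ((d.choose k : ℝ) * ∫ x, x ^ k ∂P) =
      ∑ k ∈ Finset.range (d + 1),
        Polynomial.monomial k ((d.choose k : ℝ) * ∫ x, x ^ k ∂Q) :=
    Polynomial.funext fun t => by
      simpa only [Polynomial.eval_finsetSum, Polynomial.eval_monomial] using h t
  have hcoeff := congrArg (fun p => Polynomial.coeff p k) hpoly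
  simp only [Polynomial.finsetSum_coeff, Polynomial.coeff_monomial, Finset.sum_ite_eq',
    Finset.mem_range_succ_iff.mpr hk, if_true] at hcoeff
  exact mul_left_cancel₀ (Nat.cast_ne_zero.mpr (Nat.choose_pos hk).ne') hcoeff
end

section
/- Let d be a natural number and let P and Q be Borel probability measures on ℝ whose absolute moments up to order d are finite. Let MMD²(P,Q) = ∫∫ (1+xy)^d dP(x)dP(y) − 2∫∫ (1+xy)^d dP(x)dQ(y) + ∫∫ (1+xy)^d dQ(x)dQ(y) be the squared maximum mean discrepancy with respect to the polynomial kernel of order d. Then for every 0 ≤ k ≤ d, C(d,k) · (m_k(P) − m_k(Q))² ≤ MMD²(P,Q); in particular |m_k(P) − m_k(Q)| ≤ MMD(P,Q) / √C(d,k). Hence decreasing the MMD with the order-d polynomial kernel forces the first d moments of the two distributions to become similar. -/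
open MeasureTheory

/-- Each binomially weighted squared moment difference is bounded by the squared
MMD with the order-`d` polynomial kernel; in particular each moment difference is
bounded by the MMD divided by the square root of the binomial coefficient. -/
theorem moment_diff_le_mmd
    (d : ℕ) (P Q : Measure ℝ) [IsProbabilityMeasure P] [IsProbabilityMeasure Q]
    (hP : ∀ k ≤ d, Integrable (fun x : ℝ => |x| ^ k) P)
    (hQ : ∀ k ≤ d, Integrable (fun x : ℝ => |x| ^ k) Q) :
    ∀ k ≤ d,
      (d.choose k : ℝ) * ((∫ x, x ^ k ∂P) - (∫ x, x ^ k ∂Q)) ^ 2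
        ≤ (∫ x, ∫ y, (1 + x * y) ^ d ∂P ∂P)
            - 2 * (∫ x, ∫ y, (1 + x * y) ^ d ∂Q ∂P)
            + (∫ x, ∫ y, (1 + x * y) ^ d ∂Q ∂Q)
      ∧ |(∫ x, x ^ k ∂P) - (∫ x, x ^ k ∂Q)|
          ≤ Real.sqrt ((∫ x, ∫ y, (1 + x * y) ^ d ∂P ∂P)
              - 2 * (∫ x, ∫ y, (1 + x * y) ^ d ∂Q ∂P)
              + (∫ x, ∫ y, (1 + x * y) ^ d ∂Q ∂Q))
            / Real.sqrt (d.choose k : ℝ) := by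
  have hP' k (hk : k ≤ d) := integrable_pow_of_integrable_abs_pow (hP k hk)
  have hQ' k (hk : k ≤ d) := integrable_pow_of_integrable_abs_pow (hQ k hk)
  intro k hk
  rw [integral_integral_one_add_mul_pow hP' hP', integral_integral_one_add_mul_pow hP' hQ',
    integral_integral_one_add_mul_pow hQ' hQ', Finset.mul_sum, ← Finset.sum_sub_distrib,
    ← Finset.sum_add_distrib]
  rw [Finset.sum_congr rfl (g := fun j =>
    (d.choose j : ℝ) * ((∫ x, x ^ j ∂P) - (∫ x, x ^ j ∂Q)) ^ 2) fun j _ => by ring]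
  have bound := Finset.single_le_sum
    (f := fun j => (d.choose j : ℝ) * ((∫ x, x ^ j ∂P) - (∫ x, x ^ j ∂Q)) ^ 2)
    (fun j _ => by positivity) (Finset.mem_range_succ_iff.mpr hk)
  refine ⟨bound, ?_⟩
  have choose_pos : (0 : ℝ) < d.choose k := by exact_mod_cast Nat.choose_pos hk
  rw [← Real.sqrt_div' _ choose_pos.le]
  refine Real.abs_le_sqrt ?_
  rw [le_div_iff₀ choose_pos, mul_comm]
  exact bound
end
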